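/- arXiv:2310.17498 — 6 statements merged into one kernel-verified Lean document; each statement's English description precedes it below -/
import Mathlib

section
/- Let d ≥ 1, σ > 0, x, r ∈ ℝ^d, and let X ~ N(x, σ²I_d) and X' ~ N(x − r, σ²I_d). Let h : ℝ^d → [0,1] be Borel measurable (a possibly randomized binary test, where h(z) is the probability that the test outputs 1 at input z), and let A = {z ∈ ℝ^d : ⟨r, z⟩ ≥ φ} for some φ ∈ ℝ. If E[h(X)] ≥ P(X ∈ A), then E[h(X')] ≥ P(X' ∈ A). -/
open MeasureTheory ProbabilityTheory

/-- The isotropic Gaussian measure `N(x, σ²I_d)` on `ℝ^d`, as the `d`-fold product of the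
one-dimensional Gaussians `N(xᵢ, σ²)`. -/
noncomputable def gaussPi (d : ℕ) (x : Fin d → ℝ) (σ : ℝ) : Measure (Fin d → ℝ) :=
  Measure.pi fun i => gaussianReal (x i) ((σ ^ 2).toNNReal)

open scoped ENNReal in
lemma pi_withDensity_of_isProbabilityMeasure {ι : Type*} [Fintype ι] {E : ι → Type*}
    [∀ i, MeasurableSpace (E i)] (μ ν : ∀ i, Measure (E i))
    [∀ i, IsProbabilityMeasure (μ i)] [∀ i, SigmaFinite (ν i)]
    (f : ∀ i, E i → ℝ≥0∞) (hf : ∀ i, Measurable (f i))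
    (hν : ∀ i, ν i = (μ i).withDensity (f i)) :
    Measure.pi ν = (Measure.pi μ).withDensity fun z => ∏ i, f i (z i) := by
  refine Measure.pi_eq fun s hs => ?_
  have hm (i : ι) : Measurable ((s i).indicator (f i)) := (hf i).indicator (hs i)
  rw [withDensity_apply _ (MeasurableSet.univ_pi hs), ← lintegral_indicator (.univ_pi hs)]
  have hind : (Set.univ.pi s).indicator (fun z => ∏ i, f i (z i))
      = fun z => ∏ i, (s i).indicator (f i) (z i) := by
    ext z
    by_cases hz : z ∈ Set.univ.pi s
    · rw [Set.indicator_of_mem hz]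
      exact Finset.prod_congr rfl fun i _ => (Set.indicator_of_mem (hz i trivial) _).symm
    · rw [Set.indicator_of_notMem hz]
      obtain ⟨i, hi⟩ : ∃ i, z i ∉ s i := by simpa [Set.mem_univ_pi] using hz
      exact (Finset.prod_eq_zero (Finset.mem_univ i) (Set.indicator_of_notMem hi _)).symm
  have hindep : iIndepFun (fun i (z : ∀ i, E i) => (s i).indicator (f i) (z i)) (Measure.pi μ) :=
    iIndepFun_pi fun i => (hm i).aemeasurable
  rw [hind, lintegral_prod_eq_prod_lintegral_of_indepFun Finset.univ _ hindep
    fun i => (hm i).comp (measurable_pi_apply i)]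
  refine Finset.prod_congr rfl fun i _ => ?_
  rw [(measurePreserving_eval μ i).lintegral_comp (hm i), lintegral_indicator (hs i), hν i,
    withDensity_apply _ (hs i)]

open scoped NNReal in
lemma gaussianReal_sub_eq_withDensity (m a : ℝ) {v : ℝ≥0} (hv : v ≠ 0) :
    gaussianReal (m - a) v = (gaussianReal m v).withDensity fun t =>
      ENNReal.ofReal (Real.exp (-(2 * a * (t - m) + a ^ 2) / (2 * v))) := by
  rw [gaussianReal_of_var_ne_zero _ hv, gaussianReal_of_var_ne_zero _ hv,
    ← withDensity_mul _ (measurable_gaussianPDF m v) (by fun_prop)]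
  congr 1
  ext t
  rw [Pi.mul_apply, gaussianPDF, gaussianPDF,
    ← ENNReal.ofReal_mul (gaussianPDFReal_nonneg m v t), gaussianPDFReal, gaussianPDFReal,
    mul_assoc _ (Real.exp _), ← Real.exp_add]
  congr 3
  ring

/-- The sufficiency half of the Neyman–Pearson lemma: among randomized tests, the indicator of a
sublevel set of the likelihood ratio minimizes the power at a given level. -/
lemma measureReal_le_integral_withDensity_of_sublevel {Ω : Type*} [MeasurableSpace Ω]
    {μ ν : Measure Ω} [IsFiniteMeasure μ] [IsFiniteMeasure ν] {L : Ω → ℝ} (hL : Measurable L)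
    (hL0 : ∀ z, 0 ≤ L z) (hν : ν = μ.withDensity fun z => ENNReal.ofReal (L z))
    {h : Ω → ℝ} (hmeas : Measurable h) (h01 : ∀ z, h z ∈ Set.Icc (0 : ℝ) 1)
    {A : Set Ω} (hA : MeasurableSet A) {c : ℝ} (hc : 0 ≤ c)
    (hLA : ∀ z ∈ A, L z ≤ c) (hLA' : ∀ z ∉ A, c ≤ L z)
    (hyp : μ.real A ≤ ∫ z, h z ∂μ) : ν.real A ≤ ∫ z, h z ∂ν := by
  have hInt (ρ : Measure Ω) [IsFiniteMeasure ρ] : Integrable h ρ :=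
    .of_bound hmeas.aestronglyMeasurable 1
      (.of_forall fun z => abs_le.2 ⟨by linarith [(h01 z).1], (h01 z).2⟩)
  have hIntA (ρ : Measure Ω) [IsFiniteMeasure ρ] : Integrable (A.indicator (1 : Ω → ℝ)) ρ :=
    (integrable_const (1 : ℝ)).indicator hA
  have hdiff (ρ : Measure Ω) [IsFiniteMeasure ρ] :
      ∫ z, (h z - A.indicator 1 z) ∂ρ = ∫ z, h z ∂ρ - ρ.real A := by
    rw [integral_sub (hInt ρ) (hIntA ρ), integral_indicator_one hA]
  have hfin : ∀ᵐ z ∂μ, ENNReal.ofReal (L z) < ⊤ := .of_forall fun _ => ENNReal.ofReal_lt_top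
  have hLint : Integrable (fun z => L z * (h z - A.indicator 1 z)) μ := by
    have := (hInt ν).sub (hIntA ν)
    rw [hν, integrable_withDensity_iff_integrable_smul' hL.ennreal_ofReal hfin] at this
    simpa [ENNReal.toReal_ofReal (hL0 _)] using this
  have hνint : ∫ z, (h z - A.indicator 1 z) ∂ν = ∫ z, L z * (h z - A.indicator 1 z) ∂μ := by
    rw [hν, integral_withDensity_eq_integral_toReal_smul hL.ennreal_ofReal hfin]
    simp [ENNReal.toReal_ofReal (hL0 _)]
  have hmono : ∫ z, c * (h z - A.indicator 1 z) ∂μ ≤ ∫ z, L z * (h z - A.indicator 1 z) ∂μ := by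
    refine integral_mono (((hInt μ).sub (hIntA μ)).const_mul c) hLint fun z => ?_
    by_cases hz : z ∈ A
    · simpa [hz] using mul_le_mul_of_nonpos_right (hLA z hz) (sub_nonpos.2 (h01 z).2)
    · simpa [hz] using mul_le_mul_of_nonneg_right (hLA' z hz) (h01 z).1
  rw [integral_const_mul, hdiff μ, ← hνint, hdiff ν] at hmono
  linarith [mul_nonneg hc (sub_nonneg.2 hyp)]

/-- **Neyman–Pearson for Gaussians with different means.**
Let `X ~ N(x, σ²I_d)` and `X' ~ N(x − r, σ²I_d)`, let `h : ℝ^d → [0,1]` be a Borel measurable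
randomized test, and let `A = {z : ⟨r, z⟩ ≥ φ}`. If `E[h(X)] ≥ P(X ∈ A)` then
`E[h(X')] ≥ P(X' ∈ A)`. -/
theorem neyman_pearson_gaussian
    (d : ℕ) (hd : 1 ≤ d) (σ : ℝ) (hσ : 0 < σ) (x r : Fin d → ℝ)
    (h : (Fin d → ℝ) → ℝ) (hmeas : Measurable h) (h01 : ∀ z, h z ∈ Set.Icc (0 : ℝ) 1)
    (φ : ℝ)
    (hyp : ∫ z, h z ∂(gaussPi d x σ)
        ≥ ((gaussPi d x σ) {z | φ ≤ ∑ i, r i * z i}).toReal) :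
    ∫ z, h z ∂(gaussPi d (x - r) σ)
        ≥ ((gaussPi d (x - r) σ) {z | φ ≤ ∑ i, r i * z i}).toReal := by
  have hv : (σ ^ 2).toNNReal ≠ 0 := by positivity
  have hv' : ((σ ^ 2).toNNReal : ℝ) = σ ^ 2 := Real.coe_toNNReal _ (sq_nonneg σ)
  let b : ℝ := ∑ i, (-2 * r i * x i + r i ^ 2)
  have hdens : gaussPi d (x - r) σ = (gaussPi d x σ).withDensity fun z =>
      ENNReal.ofReal (Real.exp (-(2 * ∑ i, r i * z i + b) / (2 * σ ^ 2))) := by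
    simp only [gaussPi, Pi.sub_apply]
    rw [pi_withDensity_of_isProbabilityMeasure _ _ _ (by fun_prop)
      fun i => gaussianReal_sub_eq_withDensity (x i) (r i) hv]
    congr 1
    ext z
    rw [← ENNReal.ofReal_prod_of_nonneg fun i _ => (Real.exp_pos _).le, ← Real.exp_sum,
      ← Finset.sum_div, Finset.sum_neg_distrib, Finset.mul_sum, ← Finset.sum_add_distrib, hv']
    congr 5
    ext i
    ring
  have : IsProbabilityMeasure (gaussPi d x σ) := by unfold gaussPi; infer_instance
  have : IsProbabilityMeasure (gaussPi d (x - r) σ) := by unfold gaussPi; infer_instance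
  refine measureReal_le_integral_withDensity_of_sublevel (by fun_prop)
    (fun z => (Real.exp_pos _).le) hdens hmeas h01 (measurableSet_le (by fun_prop) (by fun_prop))
    (Real.exp_pos (-(2 * φ + b) / (2 * σ ^ 2))).le (fun z hz => ?_) (fun z hz => ?_) hyp
  · have : φ ≤ ∑ i, r i * z i := hz
    gcongr
  · have : ∑ i, r i * z i ≤ φ := (not_le.1 hz).le
    gcongr
end

section
/- Let f : ℝ^d → {1,…,K} be Borel measurable, σ > 0, t ∈ {1,…,K}, and let x, x' ∈ ℝ^d with r = x' − x. If P_{ε~N(0,σ²I_d)}(f(x' + ε) = t) ≥ 1 − Φ(a) for some a ∈ ℝ, then P_{ε~N(0,σ²I_d)}(f(x + ε) = t) ≥ 1 − Φ(a + ‖r‖₂/σ). -/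
open MeasureTheory ProbabilityTheory

/-- The standard normal CDF `Φ`. -/
noncomputable def stdPhi (a : ℝ) : ℝ := ((gaussianReal 0 1) (Set.Iic a)).toReal

open scoped ENNReal

/-- **Neyman–Pearson**: a superlevel set of the likelihood ratio is a most powerful test. -/
lemma measure_le_of_withDensity_le {α : Type*} [MeasurableSpace α] (μ : Measure α)
    [IsFiniteMeasure μ] {g : α → ℝ≥0∞} [IsFiniteMeasure (μ.withDensity g)] {k : ℝ≥0∞}
    (hk0 : k ≠ 0) (hk : k ≠ ∞) {H B : Set α} (hH : MeasurableSet H) (hB : MeasurableSet B)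
    (hge : ∀ z ∈ H, k ≤ g z) (hle : ∀ z ∉ H, g z ≤ k)
    (h : μ.withDensity g H ≤ μ.withDensity g B) : μ H ≤ μ B := by
  have hdiff (ν : Measure α) [IsFiniteMeasure ν] : ν H ≤ ν B ↔ ν (H \ B) ≤ ν (B \ H) := by
    rw [← measure_inter_add_sdiff H hB, ← measure_inter_add_sdiff B hH, Set.inter_comm B H,
      ENNReal.add_le_add_iff_left (measure_ne_top _ _)]
  rw [hdiff] at h ⊢
  have h₁ : k * μ (H \ B) ≤ μ.withDensity g (H \ B) := by
    rw [withDensity_apply _ (hH.diff hB), ← setLIntegral_const]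
    exact setLIntegral_mono' (hH.diff hB) fun z hz => hge z hz.1
  have h₂ : μ.withDensity g (B \ H) ≤ k * μ (B \ H) := by
    rw [withDensity_apply _ (hB.diff hH), ← setLIntegral_const]
    exact setLIntegral_mono' (hB.diff hH) fun z hz => hle z hz.2
  exact (ENNReal.mul_le_mul_iff_right hk0 hk).1 (h₁.trans (h.trans h₂))

lemma pi_withDensity {ι : Type*} [Fintype ι] {α : ι → Type*} [∀ i, MeasurableSpace (α i)]
    (μ : ∀ i, Measure (α i)) [∀ i, IsProbabilityMeasure (μ i)] {g : ∀ i, α i → ℝ≥0∞}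
    (hg : ∀ i, Measurable (g i)) [∀ i, SigmaFinite ((μ i).withDensity (g i))] :
    Measure.pi (fun i => (μ i).withDensity (g i))
      = (Measure.pi μ).withDensity fun z => ∏ i, g i (z i) := by
  refine Measure.pi_eq fun s hs => ?_
  have hm : ∀ i, Measurable ((s i).indicator (g i)) := fun i => (hg i).indicator (hs i)
  rw [withDensity_apply _ (MeasurableSet.univ_pi hs),
    ← lintegral_indicator (MeasurableSet.univ_pi hs)]
  have hind : (Set.univ.pi s).indicator (fun z => ∏ i, g i (z i))
      = fun z => ∏ i, (s i).indicator (g i) (z i) := by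
    ext z
    by_cases hz : z ∈ Set.univ.pi s
    · rw [Set.indicator_of_mem hz]
      exact Finset.prod_congr rfl fun i _ => (Set.indicator_of_mem (hz i trivial) _).symm
    · rw [Set.indicator_of_notMem hz]
      obtain ⟨i, hi⟩ : ∃ i, z i ∉ s i := by simpa using hz
      exact (Finset.prod_eq_zero (Finset.mem_univ i) (Set.indicator_of_notMem hi _)).symm
  rw [hind]
  refine (lintegral_prod_eq_prod_lintegral_of_indepFun Finset.univ
    (fun i (z : ∀ i, α i) => (s i).indicator (g i) (z i))
    (iIndepFun_pi fun i => (hm i).aemeasurable)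
    fun i => (hm i).comp (measurable_pi_apply i)).trans ?_
  refine Finset.prod_congr rfl fun i _ => ?_
  rw [withDensity_apply _ (hs i), ← lintegral_indicator (hs i),
    ← (measurePreserving_eval μ i).lintegral_comp (hm i)]

lemma gaussianReal_one_eq_withDensity (m : ℝ) :
    gaussianReal m 1
      = (gaussianReal 0 1).withDensity fun z => ENNReal.ofReal (Real.exp (m * z - m ^ 2 / 2)) := by
  rw [gaussianReal_of_var_ne_zero _ one_ne_zero, gaussianReal_of_var_ne_zero _ one_ne_zero,
    ← withDensity_mul _ (measurable_gaussianPDF _ _) (by fun_prop)]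
  congr 1
  ext z
  rw [Pi.mul_apply, gaussianPDF, gaussianPDF,
    ← ENNReal.ofReal_mul (gaussianPDFReal_nonneg _ _ _), gaussianPDFReal, gaussianPDFReal,
    mul_assoc _ (Real.exp _), ← Real.exp_add]
  congr 3
  push_cast
  ring

section StandardGaussian

variable {ι : Type*} [Fintype ι]

/-- Cameron–Martin formula for the standard Gaussian on `ι → ℝ`. -/
lemma pi_gaussianReal_map_add (u : ι → ℝ) :
    (Measure.pi fun _ : ι => gaussianReal 0 1).map (fun z => z + u)
      = (Measure.pi fun _ : ι => gaussianReal 0 1).withDensity fun z =>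
          ENNReal.ofReal (Real.exp (∑ i, u i * z i - (∑ i, u i ^ 2) / 2)) := by
  have hmap : (Measure.pi fun _ : ι => gaussianReal 0 1).map (fun z => z + u)
      = Measure.pi fun i => gaussianReal (u i) 1 := by
    have := Measure.pi_map_pi (μ := fun _ : ι => gaussianReal 0 1) (f := fun i z => z + u i)
      fun i => by fun_prop
    simp only [gaussianReal_map_add_const, zero_add] at this
    exact this
  have (i : ι) : SigmaFinite ((gaussianReal 0 1).withDensity
      fun z => ENNReal.ofReal (Real.exp (u i * z - u i ^ 2 / 2))) := by
    rw [← gaussianReal_one_eq_withDensity]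
    infer_instance
  rw [hmap, funext fun i => gaussianReal_one_eq_withDensity (u i),
    pi_withDensity _ fun i => by fun_prop]
  congr 1
  ext z
  rw [← ENNReal.ofReal_prod_of_nonneg fun i _ => (Real.exp_pos _).le, ← Real.exp_sum,
    Finset.sum_sub_distrib, Finset.sum_div]

lemma pi_gaussianReal_map_sum_mul {w : ι → ℝ} (hw : ∑ i, w i ^ 2 = 1) :
    (Measure.pi fun _ : ι => gaussianReal 0 1).map (fun z => ∑ i, w i * z i)
      = gaussianReal 0 1 := by
  have hL : (fun z : ι → ℝ => ∑ i, w i * z i)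
      = innerSL ℝ (WithLp.toLp 2 w : EuclideanSpace ℝ ι) ∘ WithLp.toLp 2 := by
    ext z
    simp [PiLp.inner_apply, mul_comm]
  rw [hL, ← Measure.map_map (by fun_prop) (by fun_prop), map_pi_eq_stdGaussian,
    IsGaussian.map_eq_gaussianReal, integral_strongDual_stdGaussian, variance_dual_stdGaussian,
    innerSL_apply_norm, EuclideanSpace.norm_sq_eq]
  simp [hw]

lemma one_sub_stdPhi (c : ℝ) : 1 - stdPhi c = (gaussianReal 0 1).real (Set.Ioi c) := by
  rw [← Set.compl_Iic, probReal_compl_eq_one_sub measurableSet_Iic]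
  rfl

lemma pi_gaussianReal_real_halfspace {w : ι → ℝ} (hw : ∑ i, w i ^ 2 = 1) (c : ℝ) :
    (Measure.pi fun _ : ι => gaussianReal 0 1).real {z | c < ∑ i, w i * z i} = 1 - stdPhi c := by
  have := map_measureReal_apply (μ := Measure.pi fun _ : ι => gaussianReal 0 1)
    (f := fun z => ∑ i, w i * z i) (by fun_prop) (measurableSet_Ioi (a := c))
  rw [pi_gaussianReal_map_sum_mul hw] at this
  rw [one_sub_stdPhi, this]
  rfl

lemma one_sub_stdPhi_add_le {B : Set (ι → ℝ)} (hB : MeasurableSet B) (u : ι → ℝ) (a : ℝ)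
    (h : 1 - stdPhi a
      ≤ (Measure.pi fun _ : ι => gaussianReal 0 1).real ((fun z => z + u) ⁻¹' B)) :
    1 - stdPhi (a + √(∑ i, u i ^ 2)) ≤ (Measure.pi fun _ : ι => gaussianReal 0 1).real B := by
  set γ := Measure.pi fun _ : ι => gaussianReal 0 1 with hγ
  have hs : 0 ≤ ∑ i, u i ^ 2 := Finset.sum_nonneg fun i _ => sq_nonneg _
  obtain ⟨n, hn⟩ : ∃ n, n = √(∑ i, u i ^ 2) := ⟨_, rfl⟩
  have hnsq : n ^ 2 = ∑ i, u i ^ 2 := by rw [hn, Real.sq_sqrt hs]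
  have hn0 : 0 ≤ n := hn ▸ Real.sqrt_nonneg _
  rw [← hn]
  rcases hn0.eq_or_lt with h0 | hpos
  · have hu : u = 0 := by
      ext i
      have : ∑ i, u i ^ 2 = 0 := by rw [← hnsq, ← h0]; simp
      exact pow_eq_zero_iff two_ne_zero |>.1
        ((Finset.sum_eq_zero_iff_of_nonneg fun i _ => sq_nonneg _).1 this i (Finset.mem_univ i))
    simpa [← h0, hu] using h
  have hw : ∑ i, (u i / n) ^ 2 = 1 := by
    simp_rw [div_pow]
    rw [← Finset.sum_div, ← hnsq, div_self (by positivity)]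
  have hsum (z : ι → ℝ) : ∑ i, u i * z i = n * ∑ i, u i / n * z i := by
    rw [Finset.mul_sum]
    refine Finset.sum_congr rfl fun i _ => ?_
    field_simp
  have hadd : Measurable fun z : ι → ℝ => z + u := by fun_prop
  set H : Set (ι → ℝ) := {z | a + n < ∑ i, u i / n * z i} with hH
  have hHm : MeasurableSet H := measurableSet_lt measurable_const (by fun_prop)
  have hpre : (fun z => z + u) ⁻¹' H = {z | a < ∑ i, u i / n * z i} := by
    have hnu : ∑ i, u i / n * u i = n := by
      have := hsum u
      simp_rw [← sq] at this
      exact mul_left_cancel₀ hpos.ne' (by rw [← this, ← hnsq, sq])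
    ext z
    simp [hH, mul_add, Finset.sum_add_distrib, hnu]
  rw [← pi_gaussianReal_real_halfspace hw, ← hpre] at h
  rw [← pi_gaussianReal_real_halfspace hw]
  refine ENNReal.toReal_mono (measure_ne_top _ _) ?_
  have hle : γ.map (fun z => z + u) H ≤ γ.map (fun z => z + u) B := by
    rw [Measure.map_apply hadd hHm, Measure.map_apply hadd hB]
    exact (ENNReal.toReal_le_toReal (measure_ne_top _ _) (measure_ne_top _ _)).1 h
  rw [hγ, pi_gaussianReal_map_add] at hle
  have : IsFiniteMeasure (γ.withDensity fun z =>
      ENNReal.ofReal (Real.exp (∑ i, u i * z i - (∑ i, u i ^ 2) / 2))) := by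
    rw [hγ, ← pi_gaussianReal_map_add]
    infer_instance
  refine measure_le_of_withDensity_le γ
    (k := ENNReal.ofReal (Real.exp (n * (a + n) - (∑ i, u i ^ 2) / 2)))
    (by simp [Real.exp_pos]) ENNReal.ofReal_ne_top hHm hB (fun z hz => ?_) (fun z hz => ?_) hle
  · rw [hsum]
    have := (show a + n < _ from hz).le
    gcongr
  · rw [hsum]
    have := not_lt.1 (show ¬ a + n < _ from hz)
    gcongr

end StandardGaussian

lemma gaussPi_zero_eq_map (d : ℕ) (σ : ℝ) :
    gaussPi d 0 σ = (Measure.pi fun _ : Fin d => gaussianReal 0 1).map (fun z => σ • z) := by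
  have := Measure.pi_map_pi (μ := fun _ : Fin d => gaussianReal 0 1) (f := fun _ z => σ * z)
    fun i => by fun_prop
  refine Eq.trans ?_ this.symm
  simp only [gaussPi, gaussianReal_map_const_mul, Pi.zero_apply, mul_zero, mul_one]
  congr! 3
  exact NNReal.eq (Real.coe_toNNReal _ (sq_nonneg σ))

/-- Let `f : ℝ^d → {1,…,K}` be Borel measurable, `σ > 0`, `t` a class, and `x, x' ∈ ℝ^d` with
`r = x' − x`. If `P_{ε~N(0,σ²I_d)}(f(x' + ε) = t) ≥ 1 − Φ(a)`, then
`P_{ε~N(0,σ²I_d)}(f(x + ε) = t) ≥ 1 − Φ(a + ‖r‖₂/σ)`. -/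
theorem gaussian_class_prob_shift
    (d K : ℕ) (hd : 1 ≤ d) (f : (Fin d → ℝ) → Fin K) (hf : Measurable f)
    (σ : ℝ) (hσ : 0 < σ) (t : Fin K) (x x' r : Fin d → ℝ) (hr : r = x' - x) (a : ℝ)
    (hyp : ((gaussPi d 0 σ) {ε | f (x' + ε) = t}).toReal ≥ 1 - stdPhi a) :
    ((gaussPi d 0 σ) {ε | f (x + ε) = t}).toReal
      ≥ 1 - stdPhi (a + Real.sqrt (∑ i, (r i) ^ 2) / σ) := by
  have hfib (y : Fin d → ℝ) : MeasurableSet {ε | f (y + ε) = t} :=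
    (hf.comp (measurable_const_add y)) (measurableSet_singleton t)
  have hσm : Measurable fun z : Fin d → ℝ => σ • z := by fun_prop
  have hnorm : √(∑ i, (r i) ^ 2) / σ = √(∑ i, (r i / σ) ^ 2) := by
    simp_rw [div_pow]
    rw [← Finset.sum_div, Real.sqrt_div' _ (sq_nonneg σ), Real.sqrt_sq hσ.le]
  rw [gaussPi_zero_eq_map, Measure.map_apply hσm (hfib _)] at hyp ⊢
  rw [hnorm]
  refine one_sub_stdPhi_add_le (hσm (hfib x)) (fun i => r i / σ) a (hyp.le.trans_eq ?_)
  rw [measureReal_def]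
  congr 2
  ext z
  have : x + σ • (z + fun i => r i / σ) = x' + σ • z := by
    ext i
    simp only [Pi.add_apply, Pi.smul_apply, smul_eq_mul, hr, Pi.sub_apply]
    field_simp
    ring
  simp only [Set.mem_preimage, Set.mem_ofPred_eq, this]
end

section
/- (Backdoor detection guarantee.) Let f : ℝ^d → {1,…,K} be Borel measurable, σ > 0, and let x_1,…,x_K ∈ ℝ^d satisfy f(x_k) = k for each k. Let δ : ℝ^d → ℝ^d be a trigger map and t ∈ {1,…,K} a target class, and set π = min_{k=1,…,K} R(x_k) and Δ = max_{k=1,…,K} ‖δ(x_k) − x_k‖₂. Let s_1,…,s_N be a calibration set of real numbers, let 0 ≤ m < N be an integer, α ∈ (0,1), l = ⌊α(N−m+1)⌋, and assume m + l < N; write s* = s_{(N−m−l)}. If π ∈ (0,1), s* ∈ (0,1), and Δ < σ·(Φ⁻¹(1 − s*) − Φ⁻¹(1 − π)), then the LDP s of f at x_1,…,x_K satisfies q_m(s) ≤ α, i.e., the attack is detected. -/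
open MeasureTheory ProbabilityTheory

/-- The inverse `Φ⁻¹` of the standard normal CDF. -/
noncomputable def stdPhiInv : ℝ → ℝ := Function.invFun stdPhi

/-- The `k`-th entry of the samplewise local probability vector (SLPV) of the classifier `f`
at `x`: `p_k(x|σ) = P_{ε~N(0,σ²I_d)}(f(x+ε) = k)`. -/
noncomputable def slpv {d K : ℕ} (f : (Fin d → ℝ) → Fin K) (σ : ℝ)
    (x : Fin d → ℝ) (k : Fin K) : ℝ :=
  ((gaussPi d 0 σ) {ε | f (x + ε) = k}).toReal

/-- The local dominant probability (LDP) of `f` at points `x 0, …, x (K-1)`: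
`s = max_k (1/K) Σ_j p_k(x_j|σ)`. -/
noncomputable def ldp {d K : ℕ} (f : (Fin d → ℝ) → Fin K) (σ : ℝ)
    (x : Fin K → Fin d → ℝ) : ℝ :=
  ⨆ k : Fin K, (1 / (K : ℝ)) * ∑ j : Fin K, slpv f σ (x j) k

/-- The `i`-th order statistic `s_{(i+1)}` (0-indexed) of the calibration scores `s`. -/
noncomputable def orderStat {N : ℕ} (s : Fin N → ℝ) (i : Fin N) : ℝ := s (Tuple.sort s i)

/-- The adjusted conformal p-value
`q_m(t) = 1 − (1 + min{#{i : s_i < t}, N−m})/(N−m+1)`. -/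
noncomputable def qConformal {N : ℕ} (s : Fin N → ℝ) (m : ℕ) (t : ℝ) : ℝ :=
  1 - (1 + (min (Finset.univ.filter fun i => s i < t).card (N - m) : ℕ)) / ((N - m : ℕ) + 1)

lemma stdPhi_strictMono : StrictMono stdPhi := by
  intro a b hab
  have := (gaussianReal_absolutelyContinuous' 0 (v := 1) one_ne_zero).isOpenPosMeasure
  have h1 : Set.Iic b = Set.Iic a ∪ Set.Ioc a b := (Set.Iic_union_Ioc_eq_Iic hab.le).symm
  have h2 : 0 < (gaussianReal 0 1) (Set.Ioc a b) :=
    (Measure.measure_Ioo_pos _ |>.2 hab).trans_le (measure_mono Set.Ioo_subset_Ioc_self)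
  unfold stdPhi
  rw [h1, measure_union (Set.Iic_disjoint_Ioc le_rfl) measurableSet_Ioc,
    ENNReal.toReal_add (measure_ne_top _ _) (measure_ne_top _ _)]
  linarith [ENNReal.toReal_pos h2.ne' (measure_ne_top _ _)]

lemma continuous_stdPhi : Continuous stdPhi := by
  have := nullSingletonClass_gaussianReal (μ := 0) (v := 1) one_ne_zero
  have h : stdPhi = fun b => ∫ _ in Set.Iic b, (1 : ℝ) ∂(gaussianReal 0 1) := by
    ext b
    simp [stdPhi, Measure.real]
  rw [h, continuous_iff_continuousAt]
  intro a
  exact (IntegrableOn.continuousOn_Iic_primitive_Iic (a₀ := a + 1)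
    (integrable_const _).integrableOn).continuousAt (Iic_mem_nhds (by linarith))

/-- `Φ⁻¹` is a right inverse of `Φ` on `(0, 1)`. -/
lemma stdPhi_stdPhiInv {p : ℝ} (hp : p ∈ Set.Ioo (0 : ℝ) 1) : stdPhi (stdPhiInv p) = p := by
  have h : stdPhi = cdf (gaussianReal 0 1) := by
    ext b
    rw [cdf_eq_real]
    rfl
  refine Function.invFun_eq ?_
  refine mem_range_of_exists_le_of_exists_ge continuous_stdPhi ?_ ?_
  · rw [h]
    exact ((tendsto_cdf_atBot (gaussianReal 0 1)).eventually_le_const hp.1).exists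
  · rw [h]
    exact ((tendsto_cdf_atTop (gaussianReal 0 1)).eventually_const_le hp.2).exists

instance (d : ℕ) (x : Fin d → ℝ) (σ : ℝ) : IsProbabilityMeasure (gaussPi d x σ) := by
  unfold gaussPi
  infer_instance

lemma gaussPi_map_add (d : ℕ) (x w : Fin d → ℝ) (σ : ℝ) :
    (gaussPi d x σ).map (fun y => y + w) = gaussPi d (x + w) σ := by
  have := Measure.pi_map_pi (μ := fun i => gaussianReal (x i) ((σ ^ 2).toNNReal))
    (f := fun i z => z + w i) (fun i => by fun_prop)
  simp only [gaussianReal_map_add_const] at this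
  exact this

/-- The law of a linear functional under a centered isotropic Gaussian. -/
lemma gaussPi_map_linear (d : ℕ) (w : Fin d → ℝ) (σ : ℝ) :
    (gaussPi d 0 σ).map (fun y => ∑ i, w i * y i)
      = gaussianReal 0 ((σ ^ 2 * ∑ i, w i ^ 2).toNNReal) := by
  have h1 := Measure.pi_map_pi (μ := fun i : Fin d => gaussianReal 0 ((σ ^ 2).toNNReal))
    (f := fun i z => w i * z) (fun i => by fun_prop)
  have h2 : (gaussPi d 0 σ).map (fun y => ∑ i, w i * y i)
      = ((gaussPi d 0 σ).map (fun y i => w i * y i)).map (fun p => ∑ i, p i) := by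
    rw [Measure.map_map (by fun_prop) (by fun_prop)]
    rfl
  rw [h2]
  have h3 : (gaussPi d 0 σ).map (fun y i => w i * y i) = _ := h1
  rw [h3]
  have : IsProbabilityMeasure ((Measure.pi fun i =>
      (gaussianReal 0 ((σ ^ 2).toNNReal)).map (fun z => w i * z)).map
        (fun p : Fin d → ℝ => ∑ i, p i)) := by
    rw [← h3, ← h2]
    exact Measure.isProbabilityMeasure_map
      (by fun_prop : Measurable fun y : Fin d → ℝ => ∑ i, w i * y i).aemeasurable
  refine Measure.ext_of_charFun ?_
  simp only [gaussianReal_map_const_mul]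
  rw [charFun_map_sum_pi_eq_prod]
  ext t
  simp only [Finset.prod_apply, charFun_gaussianReal]
  rw [← Complex.exp_sum]
  congr 1
  have hσ : ((σ ^ 2).toNNReal : ℝ) = σ ^ 2 := Real.coe_toNNReal _ (sq_nonneg _)
  have hs : ((σ ^ 2 * ∑ i, w i ^ 2).toNNReal : ℝ) = σ ^ 2 * ∑ i, w i ^ 2 :=
    Real.coe_toNNReal _ (by positivity)
  have hs' : (((σ ^ 2 * ∑ i, w i ^ 2).toNNReal : ℝ) : ℂ) = (σ : ℂ) ^ 2 * ∑ i, (w i : ℂ) ^ 2 := by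
    rw [hs]; push_cast; rfl
  rw [hs']
  simp only [NNReal.coe_mul, hσ]
  simp [Finset.mul_sum, Finset.sum_mul, Finset.sum_div]
  exact Finset.sum_congr rfl fun i _ => by ring

/-- The mass of a half-space under a centered isotropic Gaussian. -/
lemma gaussPi_halfSpace (d : ℕ) (w : Fin d → ℝ) {σ r : ℝ} (hσ : 0 < σ) (hr : 0 < r)
    (hw : ∑ i, w i ^ 2 = r ^ 2) (c : ℝ) :
    (gaussPi d 0 σ).real {y | ∑ i, w i * y i ≤ c * (σ * r)} = stdPhi c := by
  have h1 : (gaussPi d 0 σ) {y | ∑ i, w i * y i ≤ c * (σ * r)}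
      = (gaussPi d 0 σ).map (fun y => ∑ i, w i * y i) (Set.Iic (c * (σ * r))) := by
    rw [Measure.map_apply (by fun_prop) measurableSet_Iic]
    rfl
  have h2 : gaussianReal 0 ((σ ^ 2 * ∑ i, w i ^ 2).toNNReal)
      = (gaussianReal 0 1).map (fun z => (σ * r) * z) := by
    rw [gaussianReal_map_const_mul, mul_zero, hw]
    congr 1
    ext
    simp [Real.coe_toNNReal _ (show 0 ≤ σ ^ 2 * r ^ 2 by positivity), mul_pow]
  rw [Measure.real, h1, gaussPi_map_linear, h2, Measure.map_apply (by fun_prop) measurableSet_Iic,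
    stdPhi]
  congr 2
  ext z
  simp only [Set.mem_preimage, Set.mem_Iic]
  rw [mul_comm c]
  exact mul_le_mul_iff_right₀ (by positivity)

lemma MeasureTheory.Measure.pi_withDensity_prod {ι : Type*} [Fintype ι] {X : ι → Type*}
    [∀ i, MeasurableSpace (X i)] (μ : ∀ i, Measure (X i)) [∀ i, IsProbabilityMeasure (μ i)]
    (g : ∀ i, X i → ENNReal) (hg : ∀ i, Measurable (g i))
    [∀ i, SigmaFinite ((μ i).withDensity (g i))] :
    Measure.pi (fun i => (μ i).withDensity (g i))
      = (Measure.pi μ).withDensity (fun x => ∏ i, g i (x i)) := by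
  refine Measure.pi_eq fun s hs => ?_
  rw [withDensity_apply _ (MeasurableSet.univ_pi hs), ← lintegral_indicator
    (MeasurableSet.univ_pi hs)]
  have h1 : (Set.univ.pi s).indicator (fun x => ∏ i, g i (x i))
      = fun x => ∏ i, (s i).indicator (g i) (x i) := by
    ext x
    by_cases hx : x ∈ Set.univ.pi s
    · rw [Set.indicator_of_mem hx]
      exact Finset.prod_congr rfl fun i _ => (Set.indicator_of_mem (hx i trivial) _).symm
    · rw [Set.indicator_of_notMem hx]
      simp only [Set.mem_univ_pi, not_forall] at hx
      obtain ⟨i, hi⟩ := hx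
      exact (Finset.prod_eq_zero (Finset.mem_univ i) (Set.indicator_of_notMem hi _)).symm
  have hm : ∀ i, Measurable ((s i).indicator (g i)) := fun i => (hg i).indicator (hs i)
  rw [h1]
  refine (lintegral_prod_eq_prod_lintegral_of_indepFun Finset.univ
    (fun i (x : ∀ i, X i) => (s i).indicator (g i) (x i)) (iIndepFun_pi fun i => (hm i).aemeasurable)
    (fun i => (hm i).comp (measurable_pi_apply i))).trans ?_
  refine Finset.prod_congr rfl fun i _ => ?_
  rw [withDensity_apply _ (hs i), ← lintegral_indicator (hs i)]
  exact lintegral_map (hm i) (measurable_pi_apply i) |>.symm.trans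
    (by rw [(measurePreserving_eval μ i).map_eq])

lemma gaussianReal_eq_withDensity (a : ℝ) {σ : ℝ} (hσ : 0 < σ) :
    gaussianReal a ((σ ^ 2).toNNReal) = (gaussianReal 0 ((σ ^ 2).toNNReal)).withDensity
      (fun y => ENNReal.ofReal (Real.exp ((a * y - a ^ 2 / 2) / σ ^ 2))) := by
  have hv : (σ ^ 2).toNNReal ≠ 0 := by simpa using hσ.ne'
  rw [gaussianReal_of_var_ne_zero _ hv, gaussianReal_of_var_ne_zero _ hv,
    ← withDensity_mul _ (measurable_gaussianPDF _ _) (by fun_prop)]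
  congr 1
  ext y
  rw [Pi.mul_apply, gaussianPDF, gaussianPDF, ← ENNReal.ofReal_mul (gaussianPDFReal_nonneg _ _ _),
    gaussianPDFReal, gaussianPDFReal, mul_assoc _ (Real.exp _) (Real.exp _), ← Real.exp_add,
    Real.coe_toNNReal _ (sq_nonneg σ)]
  congr 3
  field_simp
  ring

/-- The Cameron–Martin formula for isotropic Gaussians. -/
lemma gaussPi_eq_withDensity (d : ℕ) (w : Fin d → ℝ) {σ : ℝ} (hσ : 0 < σ) :
    gaussPi d w σ = (gaussPi d 0 σ).withDensity (fun y =>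
      ENNReal.ofReal (Real.exp ((∑ i, w i * y i - (∑ i, w i ^ 2) / 2) / σ ^ 2))) := by
  have h := fun i => gaussianReal_eq_withDensity (w i) hσ
  have : ∀ i, SigmaFinite ((gaussianReal 0 ((σ ^ 2).toNNReal)).withDensity
      (fun y => ENNReal.ofReal (Real.exp ((w i * y - w i ^ 2 / 2) / σ ^ 2)))) := fun i => by
    rw [← h i]
    infer_instance
  have h2 := Measure.pi_withDensity_prod (fun _ : Fin d => gaussianReal 0 ((σ ^ 2).toNNReal))
    (fun i y => ENNReal.ofReal (Real.exp ((w i * y - w i ^ 2 / 2) / σ ^ 2)))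
    (fun i => by fun_prop)
  simp only [← h] at h2
  refine h2.trans ?_
  unfold gaussPi
  congr 1
  ext y
  rw [← ENNReal.ofReal_prod_of_nonneg (fun i _ => (Real.exp_pos _).le), ← Real.exp_sum,
    ← Finset.sum_div, Finset.sum_sub_distrib, Finset.sum_div]

/-- A form of the Neyman–Pearson lemma. -/
lemma withDensity_le_of_measure_le {X : Type*} [MeasurableSpace X] (P : Measure X)
    [IsFiniteMeasure P] (g : X → ENNReal) {C D : Set X} (hC : MeasurableSet C)
    (hD : MeasurableSet D) (k : ENNReal) (hkD : ∀ y ∈ D, k ≤ g y) (hkD' : ∀ y ∉ D, g y ≤ k)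
    (h : P C ≤ P D) : P.withDensity g C ≤ P.withDensity g D := by
  have hdiff : P (C \ D) ≤ P (D \ C) := by
    rw [← measure_inter_add_sdiff C hD, ← measure_inter_add_sdiff D hC, Set.inter_comm D C] at h
    exact (ENNReal.add_le_add_iff_left (measure_ne_top _ _)).1 h
  have h1 : P.withDensity g (C \ D) ≤ k * P (C \ D) := by
    rw [withDensity_apply _ (hC.diff hD), ← setLIntegral_const]
    exact setLIntegral_mono' (hC.diff hD) fun y hy => hkD' y hy.2
  have h2 : k * P (D \ C) ≤ P.withDensity g (D \ C) := by
    rw [withDensity_apply _ (hD.diff hC), ← setLIntegral_const]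
    exact setLIntegral_mono' (hD.diff hC) fun y hy => hkD y hy.1
  rw [← measure_inter_add_sdiff C hD, ← measure_inter_add_sdiff D hC, Set.inter_comm D C]
  exact add_le_add_right (h1.trans ((mul_le_mul_right hdiff k).trans h2)) _

/-- Translating an isotropic Gaussian by a vector of norm `r` increases the mass of a set of mass
at most `Φ(c)` to at most `Φ(c + r/σ)`. -/
lemma gaussPi_le_stdPhi_add (d : ℕ) (w : Fin d → ℝ) {σ r : ℝ} (hσ : 0 < σ) (hr : 0 ≤ r)
    (hw : ∑ i, w i ^ 2 = r ^ 2) {C : Set (Fin d → ℝ)} (hC : MeasurableSet C) {c : ℝ}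
    (h : (gaussPi d 0 σ).real C ≤ stdPhi c) :
    (gaussPi d w σ).real C ≤ stdPhi (c + r / σ) := by
  rcases hr.eq_or_lt with rfl | hr
  · have hw0 : w = 0 := by
      rw [zero_pow two_ne_zero, Finset.sum_eq_zero_iff_of_nonneg (fun i _ => sq_nonneg _)] at hw
      ext i
      simpa using hw i (Finset.mem_univ i)
    simpa [hw0] using h
  set D : Set (Fin d → ℝ) := {y | ∑ i, (-w i) * y i ≤ c * (σ * r)} with hDdef
  have hw' : ∑ i, (-w i) ^ 2 = r ^ 2 := by simpa using hw
  have hD : MeasurableSet D := measurableSet_le (by fun_prop) measurable_const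
  have hPD : (gaussPi d 0 σ).real D = stdPhi c := gaussPi_halfSpace d _ hσ hr hw' c
  have hle : gaussPi d 0 σ C ≤ gaussPi d 0 σ D :=
    (ENNReal.toReal_le_toReal (measure_ne_top _ _) (measure_ne_top _ _)).1 (h.trans hPD.ge)
  have hQ : gaussPi d w σ C ≤ gaussPi d w σ D := by
    rw [gaussPi_eq_withDensity d w hσ]
    refine withDensity_le_of_measure_le _ _ hC hD
      (ENNReal.ofReal (Real.exp ((-(c * (σ * r)) - (∑ i, w i ^ 2) / 2) / σ ^ 2))) ?_ ?_ hle
    · intro y hy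
      simp only [hDdef, Set.mem_ofPred_eq, neg_mul, Finset.sum_neg_distrib] at hy
      gcongr
      linarith
    · intro y hy
      simp only [hDdef, Set.mem_ofPred_eq, neg_mul, Finset.sum_neg_distrib, not_le] at hy
      gcongr
      linarith
  have hQD : (gaussPi d w σ).real D = stdPhi (c + r / σ) := by
    rw [← gaussPi_halfSpace d (fun i => -w i) hσ hr hw', ← zero_add w, ← gaussPi_map_add,
      map_measureReal_apply (by fun_prop) hD, zero_add]
    congr 1
    ext y
    have : ∑ i, -w i * (y i + w i) = ∑ i, -w i * y i - r ^ 2 := by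
      rw [← hw, ← Finset.sum_sub_distrib]
      exact Finset.sum_congr rfl fun i _ => by ring
    simp only [hDdef, Set.mem_preimage, Set.mem_ofPred_eq, Pi.add_apply, this]
    rw [show (c + r / σ) * (σ * r) = c * (σ * r) + r ^ 2 by field_simp]
    constructor <;> intro h <;> linarith
  rw [← hQD]
  exact ENNReal.toReal_mono (measure_ne_top _ _) hQ

/-- Randomized smoothing: a lower bound on the local probability of a class at `b` certifies a
lower bound at `a`. -/
lemma one_sub_stdPhi_le_slpv {d K : ℕ} {f : (Fin d → ℝ) → Fin K} (hf : Measurable f) {σ : ℝ}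
    (hσ : 0 < σ) (a b : Fin d → ℝ) (k : Fin K) {c : ℝ} (h : 1 - stdPhi c ≤ slpv f σ b k) :
    1 - stdPhi (c + √(∑ i, (b i - a i) ^ 2) / σ) ≤ slpv f σ a k := by
  have hm : ∀ z : Fin d → ℝ, MeasurableSet {ε | f (z + ε) = k} := fun z =>
    (hf.comp (measurable_const_add z)) (measurableSet_singleton k)
  have hc : ∀ z, (gaussPi d 0 σ).real {ε | f (z + ε) = k}ᶜ = 1 - slpv f σ z k := fun z =>
    probReal_compl_eq_one_sub (hm z)
  have hw : ∑ i, (a - b) i ^ 2 = √(∑ i, (b i - a i) ^ 2) ^ 2 := by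
    rw [Real.sq_sqrt (by positivity)]
    exact Finset.sum_congr rfl fun i _ => by simp only [Pi.sub_apply]; ring
  have key := gaussPi_le_stdPhi_add d (a - b) hσ (Real.sqrt_nonneg _) hw (hm b).compl (c := c)
    (by rw [hc]; linarith)
  rw [← zero_add (a - b), ← gaussPi_map_add, map_measureReal_apply (by fun_prop) (hm b).compl]
    at key
  have hs : (fun y => y + (a - b)) ⁻¹' {ε | f (b + ε) = k}ᶜ = {ε | f (a + ε) = k}ᶜ := by
    ext y
    have : b + (y + (a - b)) = a + y := by abel
    simp [this]
  rw [hs, hc] at key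
  linarith

lemma succ_le_card_filter_lt_of_orderStat_lt {N : ℕ} (s : Fin N → ℝ) (i : Fin N) {t : ℝ}
    (h : orderStat s i < t) : (i : ℕ) + 1 ≤ (Finset.univ.filter fun j => s j < t).card := by
  rw [← Fin.card_Iic i]
  refine Finset.card_le_card_of_injOn (Tuple.sort s) ?_ (Tuple.sort s).injective.injOn
  intro j hj
  have hj' : j ≤ i := by simpa using hj
  simpa using (Tuple.monotone_sort s hj').trans_lt h


/-- **Backdoor detection guarantee.** If the minimum samplewise trigger robustness `π` and the
maximum trigger perturbation magnitude `Δ` satisfy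
`Δ < σ·(Φ⁻¹(1 − s_{(N−m−l)}) − Φ⁻¹(1 − π))`, then the adjusted conformal p-value of the LDP
is at most `α`, i.e. the attack is detected. -/
theorem backdoor_detection_guarantee
    (d K : ℕ) (hd : 1 ≤ d) (hK : 1 ≤ K) (f : (Fin d → ℝ) → Fin K) (hf : Measurable f)
    (σ : ℝ) (hσ : 0 < σ) (x : Fin K → Fin d → ℝ) (hx : ∀ k : Fin K, f (x k) = k)
    (δ : (Fin d → ℝ) → Fin d → ℝ) (t : Fin K)
    (π Δ : ℝ)
    (hπ : π = ⨅ k : Fin K, slpv f σ (δ (x k)) t)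
    (hΔ : Δ = ⨆ k : Fin K, Real.sqrt (∑ i, (δ (x k) i - x k i) ^ 2))
    (N m : ℕ) (hm : m < N) (s : Fin N → ℝ)
    (α : ℝ) (hα : α ∈ Set.Ioo (0 : ℝ) 1)
    (l : ℕ) (hl : l = ⌊α * ((N - m + 1 : ℕ) : ℝ)⌋₊) (hml : m + l < N)
    (hπ01 : π ∈ Set.Ioo (0 : ℝ) 1)
    (hs01 : orderStat s ⟨N - m - l - 1, by omega⟩ ∈ Set.Ioo (0 : ℝ) 1)
    (hcert : Δ < σ * (stdPhiInv (1 - orderStat s ⟨N - m - l - 1, by omega⟩)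
        - stdPhiInv (1 - π))) :
    qConformal s m (ldp f σ x) ≤ α := by
  have : NeZero K := ⟨by omega⟩
  set S := orderStat s ⟨N - m - l - 1, by omega⟩ with hS
  have hS' : 1 - S ∈ Set.Ioo (0 : ℝ) 1 := ⟨by linarith [hs01.2], by linarith [hs01.1]⟩
  have hπ' : 1 - π ∈ Set.Ioo (0 : ℝ) 1 := ⟨by linarith [hπ01.2], by linarith [hπ01.1]⟩
  have hpt : ∀ j, S < slpv f σ (x j) t := by
    intro j
    have h1 : π ≤ slpv f σ (δ (x j)) t := hπ ▸ ciInf_le (Set.finite_range _).bddBelow j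
    have h2 : √(∑ i, (δ (x j) i - x j i) ^ 2) ≤ Δ :=
      hΔ ▸ le_ciSup (f := fun k => √(∑ i, (δ (x k) i - x k i) ^ 2))
        (Set.finite_range _).bddAbove j
    have h3 := one_sub_stdPhi_le_slpv hf hσ (x j) (δ (x j)) t (c := stdPhiInv (1 - π))
      (by rw [stdPhi_stdPhiInv hπ']; linarith)
    have h4 : √(∑ i, (δ (x j) i - x j i) ^ 2) / σ < stdPhiInv (1 - S) - stdPhiInv (1 - π) := by
      rw [div_lt_iff₀ hσ]
      linarith
    have h5 := stdPhi_strictMono (lt_sub_iff_add_lt'.1 h4)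
    rw [stdPhi_stdPhiInv hS'] at h5
    linarith
  have hldp : S < ldp f σ x := by
    have hK0 : (0 : ℝ) < K := by exact_mod_cast hK
    have h1 : (1 / (K : ℝ)) * ∑ j, slpv f σ (x j) t ≤ ldp f σ x :=
      le_ciSup (f := fun k => (1 / (K : ℝ)) * ∑ j, slpv f σ (x j) k)
        (Set.finite_range _).bddAbove t
    refine lt_of_lt_of_le ?_ h1
    have h2 : ∑ _j : Fin K, S < ∑ j, slpv f σ (x j) t :=
      Finset.sum_lt_sum_of_nonempty ⟨t, Finset.mem_univ t⟩ fun j _ => hpt j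
    rw [Finset.sum_const, Finset.card_univ, Fintype.card_fin, nsmul_eq_mul] at h2
    rw [one_div, inv_mul_eq_div, lt_div_iff₀ hK0]
    linarith
  have hcard := succ_le_card_filter_lt_of_orderStat_lt s _ hldp
  have hmin : N - m - l ≤ min (Finset.univ.filter fun i => s i < ldp f σ x).card (N - m) :=
    le_min (by simp only at hcard; omega) (by omega)
  have hfl : (l : ℝ) ≤ α * ((N - m + 1 : ℕ) : ℝ) := by
    rw [hl]
    exact Nat.floor_le (mul_nonneg hα.1.le (Nat.cast_nonneg _))
  have hsum : ((N - m : ℕ) : ℝ)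
      ≤ (min (Finset.univ.filter fun i => s i < ldp f σ x).card (N - m) : ℕ) + l := by
    exact_mod_cast (by omega : N - m ≤ _ + l)
  push_cast only [Nat.cast_add, Nat.cast_one] at hfl
  have hpos : (0 : ℝ) < ((N - m : ℕ) : ℝ) + 1 := by positivity
  unfold qConformal
  rw [sub_le_comm, le_div_iff₀ hpos]
  linarith
end

section
/- Let s_1,…,s_N be fixed real numbers, let 0 ≤ m < N be an integer, α ∈ (0,1), and l = ⌊α(N−m+1)⌋, with m + l < N. Let S be a real-valued random variable with cumulative distribution function F̃. Then P(q_m(S) ≤ α) = 1 − F̃(s_{(N−m−l)}). -/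
open MeasureTheory

/-- The `(i+1)`-st smallest value lies below `t` iff at least `i + 1` of the values do. -/
theorem orderStat_lt_iff {N : ℕ} (s : Fin N → ℝ) (i : Fin N) (t : ℝ) :
    orderStat s i < t ↔ (i : ℕ) + 1 ≤ (Finset.univ.filter fun j => s j < t).card := by
  have hmono : Monotone (s ∘ Tuple.sort s) := Tuple.monotone_sort s
  have hcard : (Finset.univ.filter fun j => s j < t).card
      = (Finset.univ.filter fun j => orderStat s j < t).card := by
    refine (Finset.card_equiv (Tuple.sort s) fun j => ?_).symm
    rw [Finset.mem_filter_univ, Finset.mem_filter_univ, orderStat]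
  rw [hcard]
  constructor
  · intro h
    rw [← Fin.card_Iic]
    refine Finset.card_le_card fun j hj => ?_
    exact Finset.mem_filter.mpr
      ⟨Finset.mem_univ j, (hmono (Finset.mem_Iic.mp hj)).trans_lt h⟩
  · intro h
    by_contra! hle
    have hsub : (Finset.univ.filter fun j => orderStat s j < t) ⊆ Finset.Iio i := by
      intro j hj
      rw [Finset.mem_Iio]
      by_contra! hij
      exact ((hle.trans (hmono hij)).trans_lt (Finset.mem_filter.mp hj).2).false
    have := Finset.card_le_card hsub
    rw [Fin.card_Iio] at this
    omega

/-- The adjusted p-value is at most `α` iff at least `N - m - ⌊α (N - m + 1)⌋` calibration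
scores lie below `t`. -/
theorem qConformal_le_iff {N : ℕ} (s : Fin N → ℝ) (m : ℕ) (t : ℝ) {α : ℝ} (hα : 0 ≤ α) :
    qConformal s m t ≤ α ↔
      N - m ≤ (Finset.univ.filter fun i => s i < t).card + ⌊α * ((N - m + 1 : ℕ) : ℝ)⌋₊ := by
  unfold qConformal
  generalize (Finset.univ.filter fun i => s i < t).card = k
  generalize N - m = M
  have hM : (0 : ℝ) < M + 1 := by positivity
  have hle : min k M ≤ M := min_le_right k M
  have hfloor : M - min k M ≤ ⌊α * ((M + 1 : ℕ) : ℝ)⌋₊ ↔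
      (M : ℝ) - (min k M : ℕ) ≤ α * (M + 1) := by
    rw [Nat.le_floor_iff (by positivity), Nat.cast_sub hle, Nat.cast_succ]
  rw [sub_le_comm, le_div_iff₀ hM]
  trans M - min k M ≤ ⌊α * ((M + 1 : ℕ) : ℝ)⌋₊
  · rw [hfloor]
    constructor <;> intro h <;> linarith
  · omega

/-- For a fixed calibration set `s₁, …, s_N` and a random score `S` with CDF `F̃`,
`P(q_m(S) ≤ α) = 1 − F̃(s_{(N−m−l)})` where `l = ⌊α(N−m+1)⌋` and `m + l < N`. -/
theorem prob_qConformal_le_alpha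
    (N m : ℕ) (hm : m < N) (s : Fin N → ℝ)
    (α : ℝ) (hα : α ∈ Set.Ioo (0 : ℝ) 1)
    (l : ℕ) (hl : l = ⌊α * ((N - m + 1 : ℕ) : ℝ)⌋₊) (hml : m + l < N)
    {Ω : Type*} [MeasurableSpace Ω] (μ : Measure Ω) [IsProbabilityMeasure μ]
    (S : Ω → ℝ) (hS : Measurable S)
    (F : ℝ → ℝ) (hF : ∀ x : ℝ, F x = (μ {ω | S ω ≤ x}).toReal) :
    (μ {ω | qConformal s m (S ω) ≤ α}).toReal
      = 1 - F (orderStat s ⟨N - m - l - 1, by omega⟩) := by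
  have hevent : {ω | qConformal s m (S ω) ≤ α}
      = {ω | S ω ≤ orderStat s ⟨N - m - l - 1, by omega⟩}ᶜ := by
    ext ω
    rw [Set.mem_ofPred_eq, Set.mem_compl_iff, Set.mem_ofPred_eq, not_le, orderStat_lt_iff,
      qConformal_le_iff s m (S ω) hα.1.le, ← hl]
    simp only
    omega
  rw [hevent, hF]
  exact probReal_compl_eq_one_sub (hS measurableSet_Iic)
end

section
/- (Asymptotic property of the false positive rate.) Fix α ∈ (0,1) and β ∈ [0,1). For each N, let m_N be an integer with 0 ≤ m_N < N and m_N/N → β as N → ∞, let l_N = ⌊α(N−m_N+1)⌋, and let Z_N be a [0,1]-valued random variable such that P(Z_N ≤ z) ≥ P(B_N ≤ z) for all z ∈ ℝ, where B_N is a random variable with the Beta(m_N+l_N+1, N−m_N−l_N) distribution (assume m_N + l_N < N). Then for every ξ > 0, lim_{N→∞} P(Z_N ≤ α + (1−α)β + ξ) = 1. -/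
open MeasureTheory Filter

/-- The Beta(a, b) probability measure on `[0,1] ⊆ ℝ`, with density
`x ↦ Γ(a+b)/(Γ(a)Γ(b)) x^(a−1) (1−x)^(b−1)`. -/
noncomputable def betaMeasure (a b : ℝ) : Measure ℝ :=
  (volume.restrict (Set.Ioo (0 : ℝ) 1)).withDensity fun x =>
    ENNReal.ofReal
      (Real.Gamma (a + b) / (Real.Gamma a * Real.Gamma b) * x ^ (a - 1) * (1 - x) ^ (b - 1))

open scoped ENNReal Topology

/-- The locally defined Beta measure agrees with Mathlib's. -/
theorem betaMeasure_eq_probabilityTheory_betaMeasure (a b : ℝ) :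
    betaMeasure a b = ProbabilityTheory.betaMeasure a b := by
  rw [betaMeasure, ProbabilityTheory.betaMeasure, ← withDensity_indicator measurableSet_Ioo]
  congr 1
  ext x
  by_cases hx : x ∈ Set.Ioo (0 : ℝ) 1
  · rw [Set.indicator_of_mem hx, ProbabilityTheory.betaPDF_of_pos_lt_one hx.1 hx.2,
      ProbabilityTheory.beta, one_div_div]
  · rw [Set.indicator_of_notMem hx, ProbabilityTheory.betaPDF_eq,
      if_neg (show ¬(0 < x ∧ x < 1) from hx), ENNReal.ofReal_zero]

theorem isProbabilityMeasure_betaMeasure {a b : ℝ} (ha : 0 < a) (hb : 0 < b) :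
    IsProbabilityMeasure (betaMeasure a b) := by
  rw [betaMeasure_eq_probabilityTheory_betaMeasure]
  exact ProbabilityTheory.isProbabilityMeasureBeta ha hb

/-- Weighting `Beta(a, b)` by `x` gives a multiple of `Beta(a + 1, b)`. -/
theorem lintegral_mul_betaMeasure {a b : ℝ} (ha : 0 < a) (hb : 0 < b) {f : ℝ → ℝ≥0∞}
    (hf : Measurable f) :
    ∫⁻ x, ENNReal.ofReal x * f x ∂betaMeasure a b
      = ENNReal.ofReal (a / (a + b)) * ∫⁻ x, f x ∂betaMeasure (a + 1) b := by
  rw [betaMeasure, betaMeasure, lintegral_withDensity_eq_lintegral_mul _ (by fun_prop)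
    (by fun_prop), lintegral_withDensity_eq_lintegral_mul _ (by fun_prop) hf,
    ← lintegral_const_mul _ (by fun_prop)]
  refine setLIntegral_congr_fun measurableSet_Ioo fun x hx => ?_
  have hx0 : 0 < x := hx.1
  simp only [Pi.mul_apply]
  rw [← mul_assoc, ← mul_assoc, ← ENNReal.ofReal_mul' hx0.le, ← ENNReal.ofReal_mul (by positivity)]
  congr 2
  have hga := (Real.Gamma_pos_of_pos ha).ne'
  have hgb := (Real.Gamma_pos_of_pos hb).ne'
  have hab : a + b ≠ 0 := by positivity
  rw [show a + 1 + b = a + b + 1 by ring, Real.Gamma_add_one ha.ne', Real.Gamma_add_one hab,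
    show a + 1 - 1 = (a - 1) + 1 by ring, Real.rpow_add_one hx0.ne']
  field_simp

/-- Moments of Beta distributions with diverging parameters converge to those of the point mass
at the limiting mean. -/
theorem tendsto_lintegral_pow_betaMeasure {ι : Type*} {u : Filter ι} {t : ℝ} (k : ℕ)
    (a b : ι → ℝ) (ha : ∀ᶠ i in u, 0 < a i) (hb : ∀ᶠ i in u, 0 < b i)
    (hab : Tendsto (fun i => a i + b i) u atTop)
    (ht : Tendsto (fun i => a i / (a i + b i)) u (𝓝 t)) :
    Tendsto (fun i => ∫⁻ x, ENNReal.ofReal x ^ k ∂betaMeasure (a i) (b i)) u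
      (𝓝 (ENNReal.ofReal t ^ k)) := by
  induction k generalizing a with
  | zero =>
    refine tendsto_const_nhds.congr' ?_
    filter_upwards [ha, hb] with i hai hbi
    have := isProbabilityMeasure_betaMeasure hai hbi
    simp
  | succ k ih =>
    have hab' : Tendsto (fun i => a i + 1 + b i) u atTop := by
      simpa only [add_right_comm] using tendsto_atTop_add_const_right u 1 hab
    have ht' : Tendsto (fun i => (a i + 1) / (a i + 1 + b i)) u (𝓝 t) := by
      have hinv : Tendsto (fun i => (a i + b i)⁻¹) u (𝓝 0) := hab.inv_tendsto_atTop
      have h := (ht.add hinv).div (hinv.const_add 1) (by norm_num)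
      rw [add_zero, add_zero, div_one] at h
      refine h.congr' ?_
      filter_upwards [ha, hb] with i hai hbi
      simp only [Pi.div_apply]
      have : a i + b i ≠ 0 := by positivity
      have : a i + b i + 1 ≠ 0 := by positivity
      have : a i + 1 + b i ≠ 0 := by positivity
      field_simp
      ring
    have hk := ih (fun i => a i + 1) (ha.mono fun i hi => by positivity) hab' ht'
    rw [pow_succ']
    refine (ENNReal.Tendsto.mul (ENNReal.tendsto_ofReal ht) (Or.inr (by finiteness)) hk
      (Or.inr ENNReal.ofReal_ne_top)).congr' ?_
    filter_upwards [ha, hb] with i hai hbi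
    simp_rw [pow_succ']
    rw [lintegral_mul_betaMeasure hai hbi (by fun_prop)]

/-- Beta distributions with diverging parameters put asymptotically no mass above any level
exceeding the limiting mean. -/
theorem tendsto_betaMeasure_Ioi {ι : Type*} {u : Filter ι} {t z : ℝ} (hz : 0 < z) (htz : t < z)
    (a b : ι → ℝ) (ha : ∀ᶠ i in u, 0 < a i) (hb : ∀ᶠ i in u, 0 < b i)
    (hab : Tendsto (fun i => a i + b i) u atTop)
    (ht : Tendsto (fun i => a i / (a i + b i)) u (𝓝 t)) :
    Tendsto (fun i => betaMeasure (a i) (b i) (Set.Ioi z)) u (𝓝 0) := by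
  have hz0 : ENNReal.ofReal z ≠ 0 := by simpa using hz
  have hr : ENNReal.ofReal t / ENNReal.ofReal z < 1 := by
    rw [ENNReal.div_lt_iff (Or.inl hz0) (Or.inl ENNReal.ofReal_ne_top), one_mul]
    exact (ENNReal.ofReal_lt_ofReal_iff hz).2 htz
  rw [ENNReal.tendsto_nhds_zero]
  intro ε hε
  obtain ⟨k, hk⟩ := ((ENNReal.tendsto_pow_atTop_nhds_zero_of_lt_one hr).eventually_lt_const
    hε).exists
  have hlim : Tendsto (fun i => (∫⁻ x, ENNReal.ofReal x ^ k ∂betaMeasure (a i) (b i))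
      / ENNReal.ofReal z ^ k) u (𝓝 ((ENNReal.ofReal t / ENNReal.ofReal z) ^ k)) := by
    rw [div_eq_mul_inv, mul_pow, ← ENNReal.inv_pow, ← div_eq_mul_inv]
    exact ENNReal.Tendsto.div_const (tendsto_lintegral_pow_betaMeasure k a b ha hb hab ht)
      (Or.inr (pow_ne_zero k hz0))
  filter_upwards [hlim.eventually_lt_const hk] with i hi
  refine le_trans ?_ hi.le
  calc betaMeasure (a i) (b i) (Set.Ioi z)
      ≤ betaMeasure (a i) (b i) {x | ENNReal.ofReal z ^ k ≤ ENNReal.ofReal x ^ k} := by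
        refine measure_mono fun x hx => ?_
        exact pow_le_pow_left' (ENNReal.ofReal_le_ofReal (le_of_lt hx)) k
    _ ≤ _ := meas_ge_le_lintegral_div (by fun_prop) (pow_ne_zero k hz0) (by finiteness)

/-- The limiting mean of the dominating Beta distributions. -/
theorem tendsto_add_floor_div {α β : ℝ} (hα : 0 ≤ α) {m : ℕ → ℕ} (hm : ∀ N, 1 ≤ N → m N < N)
    (hmlim : Tendsto (fun N => (m N : ℝ) / (N : ℝ)) atTop (𝓝 β)) :
    Tendsto (fun N : ℕ => ((m N : ℝ) + (⌊α * ((N - m N + 1 : ℕ) : ℝ)⌋₊ : ℝ) + 1) / ((N : ℝ) + 1))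
      atTop (𝓝 (α + (1 - α) * β)) := by
  have hinv : Tendsto (fun N : ℕ => (N : ℝ)⁻¹) atTop (𝓝 0) := tendsto_inv_atTop_nhds_zero_nat
  have key : ∀ c : ℝ, Tendsto (fun N : ℕ => ((m N : ℝ) + α * ((N : ℝ) - m N + 1) + c)
      / ((N : ℝ) + 1)) atTop (𝓝 (α + (1 - α) * β)) := by
    intro c
    have h := ((hmlim.add (((hmlim.const_sub 1).add hinv).const_mul α)).add
      (hinv.const_mul c)).div (hinv.const_add 1) (by norm_num)
    have he : (β + α * (1 - β + 0) + c * 0) / (1 + 0) = α + (1 - α) * β := by ring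
    rw [he] at h
    refine h.congr' ?_
    filter_upwards [eventually_ge_atTop 1] with N hN
    have hN0 : (N : ℝ) ≠ 0 := by positivity
    have hN1 : (N : ℝ) + 1 ≠ 0 := by positivity
    simp only [Pi.div_apply]
    field_simp
  refine tendsto_of_tendsto_of_tendsto_of_le_of_le' (key 0) (key 1) ?_ ?_
  all_goals
    filter_upwards [eventually_ge_atTop 1] with N hN
    have hcast : ((N - m N + 1 : ℕ) : ℝ) = (N : ℝ) - m N + 1 := by
      rw [Nat.cast_add, Nat.cast_sub (hm N hN).le, Nat.cast_one]
    rw [hcast]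
    gcongr ?_ / _
  · linarith [Nat.lt_floor_add_one (α * ((N : ℝ) - m N + 1))]
  · have hmN : (m N : ℝ) < N := by exact_mod_cast hm N hN
    linarith [Nat.floor_le (mul_nonneg hα (by linarith : (0 : ℝ) ≤ (N : ℝ) - m N + 1))]

/-- **Asymptotic property of the false positive rate.**
If `m_N/N → β`, `l_N = ⌊α(N−m_N+1)⌋`, and each `Z_N` (valued in `[0,1]`) is first-order
stochastically dominated by a `Beta(m_N+l_N+1, N−m_N−l_N)` random variable, then for every
`ξ > 0`, `P(Z_N ≤ α + (1−α)β + ξ) → 1` as `N → ∞`. -/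
theorem fpr_asymptotic
    (α β : ℝ) (hα : α ∈ Set.Ioo (0 : ℝ) 1) (hβ : β ∈ Set.Ico (0 : ℝ) 1)
    (m : ℕ → ℕ) (hm : ∀ N, 1 ≤ N → m N < N)
    (hmlim : Tendsto (fun N => (m N : ℝ) / (N : ℝ)) atTop (nhds β))
    (l : ℕ → ℕ) (hl : ∀ N, l N = ⌊α * ((N - m N + 1 : ℕ) : ℝ)⌋₊)
    (hml : ∀ N, 1 ≤ N → m N + l N < N)
    {Ω : Type*} [MeasurableSpace Ω] (μ : Measure Ω) [IsProbabilityMeasure μ]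
    (Z : ℕ → Ω → ℝ) (hZmeas : ∀ N, Measurable (Z N))
    (hZ01 : ∀ N ω, Z N ω ∈ Set.Icc (0 : ℝ) 1)
    (hdom : ∀ N, ∀ z : ℝ,
      (μ {ω | Z N ω ≤ z}).toReal
        ≥ ((betaMeasure ((m N : ℝ) + (l N : ℝ) + 1) ((N - m N - l N : ℕ) : ℝ))
            (Set.Iic z)).toReal)
    (ξ : ℝ) (hξ : 0 < ξ) :
    Tendsto (fun N => (μ {ω | Z N ω ≤ α + (1 - α) * β + ξ}).toReal) atTop (nhds 1) := by
  have ht0 : 0 < α + (1 - α) * β := by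
    have := mul_nonneg (sub_nonneg.2 hα.2.le) hβ.1
    linarith [hα.1]
  have hsum : ∀ᶠ N : ℕ in atTop, (N : ℝ) + 1
      = ((m N : ℝ) + (l N : ℝ) + 1) + ((N - m N - l N : ℕ) : ℝ) := by
    filter_upwards [eventually_ge_atTop 1] with N hN
    have := hml N hN
    rw [Nat.sub_sub, Nat.cast_sub this.le]
    push_cast
    ring
  have ha : ∀ N, 0 < (m N : ℝ) + (l N : ℝ) + 1 := fun N => by positivity
  have hb : ∀ᶠ N : ℕ in atTop, (0 : ℝ) < ((N - m N - l N : ℕ) : ℝ) := by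
    filter_upwards [eventually_ge_atTop 1] with N hN
    have := hml N hN
    exact_mod_cast (by lia : 0 < N - m N - l N)
  have htail := tendsto_betaMeasure_Ioi (z := α + (1 - α) * β + ξ) (by positivity)
    (lt_add_of_pos_right _ hξ) _ _ (Eventually.of_forall ha) hb
    ((tendsto_atTop_add_const_right _ 1 tendsto_natCast_atTop_atTop).congr' hsum)
    ((tendsto_add_floor_div hα.1.le hm hmlim).congr' (by
      filter_upwards [hsum] with N hN
      rw [← hN, hl]))
  have hlow := ((ENNReal.tendsto_toReal ENNReal.zero_ne_top).comp htail).const_sub 1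
  rw [ENNReal.toReal_zero, sub_zero] at hlow
  refine tendsto_of_tendsto_of_tendsto_of_le_of_le' hlow tendsto_const_nhds ?_
    (Eventually.of_forall fun N => measureReal_le_one)
  filter_upwards [hb] with N hbN
  have := isProbabilityMeasure_betaMeasure (ha N) hbN
  refine le_trans (le_of_eq ?_) (hdom N _)
  rw [← Set.compl_Ioi]
  exact (probReal_compl_eq_one_sub measurableSet_Ioi).symm
end

section
/- Assume c_b(1) ≥ c_a(1), i.e., the maximum in the expected LDP of the Bayes classifier g_1 is attained at class b. Then for any thresholds t_2 ≥ t_1 ≥ 1, the expected LDPs satisfy s(t_2) ≥ s(t_1) ≥ s(1) = c_b(1): the more the decision boundary deviates from the Bayes-optimal one, the larger the expected LDP. -/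
open MeasureTheory ProbabilityTheory

/-- `P_{ε~N(0,σ²I_d)}(g_t(z+ε) = a)`, where the threshold classifier `g_t` outputs class `a`
iff `μa > t·μb`. -/
noncomputable def probClassA (d : ℕ) (σ : ℝ) (μa μb : (Fin d → ℝ) → ℝ) (t : ℝ)
    (z : Fin d → ℝ) : ℝ :=
  ((gaussPi d 0 σ) {ε | t * μb (z + ε) < μa (z + ε)}).toReal

/-- `P_{ε~N(0,σ²I_d)}(g_t(z+ε) = b)`, where the threshold classifier `g_t` outputs class `b`
iff `μa ≤ t·μb`. -/
noncomputable def probClassB (d : ℕ) (σ : ℝ) (μa μb : (Fin d → ℝ) → ℝ) (t : ℝ)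
    (z : Fin d → ℝ) : ℝ :=
  ((gaussPi d 0 σ) {ε | μa (z + ε) ≤ t * μb (z + ε)}).toReal

/-- The `a`-component of the expected LDP of `g_t`:
`c_a(t) = (1/2)(∫ P(g_t(z+ε)=a) μa(z) dz + ∫ P(g_t(z+ε)=a) μb(z) dz)`. -/
noncomputable def cA (d : ℕ) (σ : ℝ) (μa μb : (Fin d → ℝ) → ℝ) (t : ℝ) : ℝ :=
  (1 / 2) * ((∫ z, probClassA d σ μa μb t z * μa z) + ∫ z, probClassA d σ μa μb t z * μb z)

/-- The `b`-component of the expected LDP of `g_t`: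
`c_b(t) = (1/2)(∫ P(g_t(z+ε)=b) μa(z) dz + ∫ P(g_t(z+ε)=b) μb(z) dz)`. -/
noncomputable def cB (d : ℕ) (σ : ℝ) (μa μb : (Fin d → ℝ) → ℝ) (t : ℝ) : ℝ :=
  (1 / 2) * ((∫ z, probClassB d σ μa μb t z * μa z) + ∫ z, probClassB d σ μa μb t z * μb z)

instance inst_s15 (d : ℕ) (x : Fin d → ℝ) (σ : ℝ) : IsProbabilityMeasure (gaussPi d x σ) := by
  unfold gaussPi; infer_instance

/-- A density stays integrable when multiplied by the probability that a Gaussian perturbation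
lands in a measurable set. -/
lemma integrable_gaussPi_translate_mul {d : ℕ} (σ : ℝ) {f : (Fin d → ℝ) → ℝ} (hf : Integrable f)
    {S : Set (Fin d → ℝ)} (hS : MeasurableSet S) :
    Integrable fun z => ((gaussPi d 0 σ) {ε | z + ε ∈ S}).toReal * f z := by
  have hmeas : Measurable fun z => (gaussPi d 0 σ) {ε | z + ε ∈ S} :=
    measurable_measure_prodMk_left (ν := gaussPi d 0 σ)
      (measurableSet_preimage (measurable_fst.add measurable_snd) hS)
  refine hf.bdd_mul (c := 1) hmeas.ennreal_toReal.aestronglyMeasurable (ae_of_all _ fun z => ?_)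
  rw [Real.norm_of_nonneg ENNReal.toReal_nonneg]
  exact measureReal_le_one

lemma integral_gaussPi_translate_mul_mono {d : ℕ} (σ : ℝ) {f : (Fin d → ℝ) → ℝ}
    (hf : Integrable f) (hf0 : ∀ z, 0 ≤ f z) {S T : Set (Fin d → ℝ)} (hS : MeasurableSet S)
    (hT : MeasurableSet T) (hST : S ⊆ T) :
    ∫ z, ((gaussPi d 0 σ) {ε | z + ε ∈ S}).toReal * f z ≤
      ∫ z, ((gaussPi d 0 σ) {ε | z + ε ∈ T}).toReal * f z := by
  refine integral_mono (integrable_gaussPi_translate_mul σ hf hS)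
    (integrable_gaussPi_translate_mul σ hf hT) fun z => ?_
  exact mul_le_mul_of_nonneg_right
    (ENNReal.toReal_mono (measure_ne_top _ _) (measure_mono fun ε hε => hST hε)) (hf0 z)

lemma cA_antitone {d : ℕ} (σ : ℝ) {μa μb : (Fin d → ℝ) → ℝ}
    (hμa_meas : Measurable μa) (hμb_meas : Measurable μb)
    (hμa : Integrable μa) (hμb : Integrable μb)
    (hμa_nonneg : ∀ z, 0 ≤ μa z) (hμb_nonneg : ∀ z, 0 ≤ μb z) :
    Antitone (cA d σ μa μb) := by
  intro s t hst
  have hmeas (r : ℝ) : MeasurableSet {x | r * μb x < μa x} :=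
    measurableSet_lt (hμb_meas.const_mul r) hμa_meas
  have hsub : {x | t * μb x < μa x} ⊆ {x | s * μb x < μa x} := fun x hx =>
    (mul_le_mul_of_nonneg_right hst (hμb_nonneg x)).trans_lt hx
  exact mul_le_mul_of_nonneg_left (add_le_add
    (integral_gaussPi_translate_mul_mono σ hμa hμa_nonneg (hmeas t) (hmeas s) hsub)
    (integral_gaussPi_translate_mul_mono σ hμb hμb_nonneg (hmeas t) (hmeas s) hsub)) (by norm_num)

lemma cB_monotone {d : ℕ} (σ : ℝ) {μa μb : (Fin d → ℝ) → ℝ}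
    (hμa_meas : Measurable μa) (hμb_meas : Measurable μb)
    (hμa : Integrable μa) (hμb : Integrable μb)
    (hμa_nonneg : ∀ z, 0 ≤ μa z) (hμb_nonneg : ∀ z, 0 ≤ μb z) :
    Monotone (cB d σ μa μb) := by
  intro s t hst
  have hmeas (r : ℝ) : MeasurableSet {x | μa x ≤ r * μb x} :=
    measurableSet_le hμa_meas (hμb_meas.const_mul r)
  have hsub : {x | μa x ≤ s * μb x} ⊆ {x | μa x ≤ t * μb x} := fun x hx =>
    le_trans hx (mul_le_mul_of_nonneg_right hst (hμb_nonneg x))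
  exact mul_le_mul_of_nonneg_left (add_le_add
    (integral_gaussPi_translate_mul_mono σ hμa hμa_nonneg (hmeas s) (hmeas t) hsub)
    (integral_gaussPi_translate_mul_mono σ hμb hμb_nonneg (hmeas s) (hmeas t) hsub)) (by norm_num)

/-- If the maximum in the expected LDP of the Bayes classifier `g_1` is attained at class `b`
(`c_b(1) ≥ c_a(1)`), then for thresholds `t_2 ≥ t_1 ≥ 1` the expected LDPs
`s(t) = max{c_a(t), c_b(t)}` satisfy `s(t_2) ≥ s(t_1) ≥ s(1) = c_b(1)`: the more the decision
boundary deviates from the Bayes-optimal one, the larger the expected LDP. -/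
theorem expected_ldp_monotone_in_threshold
    (d : ℕ) (hd : 1 ≤ d) (σ : ℝ) (hσ : 0 < σ)
    (μa μb : (Fin d → ℝ) → ℝ)
    (hμa_meas : Measurable μa) (hμa_nonneg : ∀ z, 0 ≤ μa z) (hμa_int : ∫ z, μa z = 1)
    (hμb_meas : Measurable μb) (hμb_nonneg : ∀ z, 0 ≤ μb z) (hμb_int : ∫ z, μb z = 1)
    (hmax : cA d σ μa μb 1 ≤ cB d σ μa μb 1)
    (t₁ t₂ : ℝ) (ht₁ : 1 ≤ t₁) (ht₂ : t₁ ≤ t₂) :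
    max (cA d σ μa μb t₂) (cB d σ μa μb t₂) ≥ max (cA d σ μa μb t₁) (cB d σ μa μb t₁)
    ∧ max (cA d σ μa μb t₁) (cB d σ μa μb t₁) ≥ max (cA d σ μa μb 1) (cB d σ μa μb 1)
    ∧ max (cA d σ μa μb 1) (cB d σ μa μb 1) = cB d σ μa μb 1 := by
  have hμa : Integrable μa := .of_integral_ne_zero (by simp [hμa_int])
  have hμb : Integrable μb := .of_integral_ne_zero (by simp [hμb_int])
  have hA := cA_antitone σ hμa_meas hμb_meas hμa hμb hμa_nonneg hμb_nonneg
  have hB := cB_monotone σ hμa_meas hμb_meas hμa hμb hμa_nonneg hμb_nonneg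
  have hs (t : ℝ) (ht : 1 ≤ t) : max (cA d σ μa μb t) (cB d σ μa μb t) = cB d σ μa μb t :=
    max_eq_right ((hA ht).trans (hmax.trans (hB ht)))
  rw [hs t₂ (ht₁.trans ht₂), hs t₁ ht₁, hs 1 le_rfl]
  exact ⟨hB ht₂, hB ht₁, rfl⟩
end
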